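/- There exists a ℂ-algebra homomorphism Cl → End_ℂ(F) sending ψ_j to the wedging operator and ψ_j^* to the contracting operator for each j ∈ ℤ; equivalently, the wedging and contracting operators on F satisfy ψ_i ψ_j^* + ψ_j^* ψ_i = δ_{ij}·id_F, ψ_i ψ_j + ψ_j ψ_i = 0, and ψ_i^* ψ_j^* + ψ_j^* ψ_i^* = 0 for all i, j ∈ ℤ. (F is the Fock space representation of Cl.) -/

import Mathlib

/-!
The complex Clifford algebra `Cl`: the ℂ-algebra with generators `ψ_j, ψ_j^*`
(`j : ℤ`) and the canonical anticommutation relations.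
-/

/-- The defining relations of the complex Clifford algebra `Cl`. -/
inductive ClCRel : FreeAlgebra ℂ (ℤ ⊕ ℤ) → FreeAlgebra ℂ (ℤ ⊕ ℤ) → Prop
  | pc (i j : ℤ) : ClCRel
      (FreeAlgebra.ι ℂ (Sum.inl i) * FreeAlgebra.ι ℂ (Sum.inr j)
        + FreeAlgebra.ι ℂ (Sum.inr j) * FreeAlgebra.ι ℂ (Sum.inl i))
      (if i = j then 1 else 0)
  | pp (i j : ℤ) : ClCRel
      (FreeAlgebra.ι ℂ (Sum.inl i) * FreeAlgebra.ι ℂ (Sum.inl j)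
        + FreeAlgebra.ι ℂ (Sum.inl j) * FreeAlgebra.ι ℂ (Sum.inl i)) 0
  | cc (i j : ℤ) : ClCRel
      (FreeAlgebra.ι ℂ (Sum.inr i) * FreeAlgebra.ι ℂ (Sum.inr j)
        + FreeAlgebra.ι ℂ (Sum.inr j) * FreeAlgebra.ι ℂ (Sum.inr i)) 0

/-- The complex Clifford algebra `Cl`. -/
abbrev ClC : Type := RingQuot ClCRel

/-- The generator `ψ_j` of `Cl`. -/
noncomputable def psi (j : ℤ) : ClC :=
  RingQuot.mkAlgHom ℂ ClCRel (FreeAlgebra.ι ℂ (Sum.inl j))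

/-- The generator `ψ_j^*` of `Cl`. -/
noncomputable def psiStar (j : ℤ) : ClC :=
  RingQuot.mkAlgHom ℂ ClCRel (FreeAlgebra.ι ℂ (Sum.inr j))

open scoped Classical

/-!
The Fock space `F`: complex vector space with basis the semi-infinite monomials
`i₁ ∧ i₂ ∧ ⋯` with `i₁ > i₂ > ⋯` and `i_n = i_{n-1} - 1` for `n ≫ 0`.  A basis
element is encoded by the set of its entries: a set of integers bounded above
containing every sufficiently negative integer.  The wedging operator `wedgeF j`
inserts `j` with sign `(-1)^(number of entries above j)`; the contracting operator
`contrF j` removes `j` with the corresponding sign.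
-/

/-- Sets of integers encoding semi-infinite monomials `i₁ ∧ i₂ ∧ ⋯`. -/
def IsFockF (S : Set ℤ) : Prop :=
  (∃ a : ℤ, ∀ s ∈ S, s ≤ a) ∧ (∃ b : ℤ, ∀ m : ℤ, m ≤ b → m ∈ S)

/-- The basis of semi-infinite monomials of `F`. -/
def FBasis : Type := {S : Set ℤ // IsFockF S}

/-- The Fock space `F`. -/
abbrev FSp : Type := FBasis →₀ ℂ

theorem IsFockF.insert {S : Set ℤ} (h : IsFockF S) (j : ℤ) : IsFockF (insert j S) := by
  obtain ⟨⟨a, ha⟩, ⟨b, hb⟩⟩ := h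
  refine ⟨⟨max a j, ?_⟩, ⟨b, ?_⟩⟩
  · rintro s (rfl | hs)
    · exact le_max_right _ _
    · exact le_trans (ha s hs) (le_max_left _ _)
  · exact fun m hm => Set.mem_insert_of_mem _ (hb m hm)

theorem IsFockF.diff {S : Set ℤ} (h : IsFockF S) (j : ℤ) : IsFockF (S \ {j}) := by
  obtain ⟨⟨a, ha⟩, ⟨b, hb⟩⟩ := h
  refine ⟨⟨a, fun s hs => ha s hs.1⟩, ⟨min b (j - 1), fun m hm => ?_⟩⟩
  refine ⟨hb m (le_trans hm (min_le_left _ _)), ?_⟩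
  have : m ≤ j - 1 := le_trans hm (min_le_right _ _)
  simp only [Set.mem_singleton_iff]
  omega

/-- The wedging operator `ψ_j` on `F`. -/
noncomputable def wedgeF (j : ℤ) : Module.End ℂ FSp :=
  Finsupp.linearCombination ℂ fun x : FBasis =>
    if j ∈ x.1 then 0
    else ((-1 : ℂ) ^ {s ∈ x.1 | j < s}.ncard) •
      Finsupp.single (⟨insert j x.1, x.2.insert j⟩ : FBasis) (1 : ℂ)

/-- The contracting operator `ψ_j^*` on `F`. -/
noncomputable def contrF (j : ℤ) : Module.End ℂ FSp :=
  Finsupp.linearCombination ℂ fun x : FBasis =>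
    if j ∈ x.1 then
      ((-1 : ℂ) ^ {s ∈ x.1 | j < s}.ncard) •
        Finsupp.single (⟨x.1 \ {j}, x.2.diff j⟩ : FBasis) (1 : ℂ)
    else 0

/-- The vector of the Fock space attached to the semi-infinite monomial with entries `S`. -/
noncomputable def fockMonomial {S : Set ℤ} (hS : IsFockF S) : FSp :=
  Finsupp.single (⟨S, hS⟩ : FBasis) 1

theorem fockMonomial_congr {S T : Set ℤ} (hS : IsFockF S) (h : S = T) :
    fockMonomial hS = fockMonomial (h ▸ hS : IsFockF T) := by
  subst h
  rfl

/-- The sign `(-1)^(number of entries of S above j)`. -/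
noncomputable def fockSign (S : Set ℤ) (j : ℤ) : ℂ := (-1) ^ {s ∈ S | j < s}.ncard

theorem IsFockF.finite_above {S : Set ℤ} (h : IsFockF S) (j : ℤ) :
    {s ∈ S | j < s}.Finite := by
  obtain ⟨⟨a, ha⟩, -⟩ := h
  exact (Set.finite_Icc j a).subset fun s hs => ⟨hs.2.le, ha s hs.1⟩

theorem fockSign_mul_self (S : Set ℤ) (j : ℤ) : fockSign S j * fockSign S j = 1 := by
  rw [fockSign, ← mul_pow]
  simp

theorem fockSign_insert {S : Set ℤ} (h : IsFockF S) {i : ℤ} (hi : i ∉ S) (j : ℤ) :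
    fockSign (insert i S) j = (if j < i then -1 else 1) * fockSign S j := by
  unfold fockSign
  split_ifs with hji
  · have : {s ∈ insert i S | j < s} = insert i {s ∈ S | j < s} := by
      ext s
      simp only [Set.mem_insert_iff, Set.mem_ofPred_eq]
      grind
    rw [this, Set.ncard_insert_of_notMem (fun hs => hi hs.1) (h.finite_above j), pow_succ']
  · have : {s ∈ insert i S | j < s} = {s ∈ S | j < s} := by
      ext s
      simp only [Set.mem_insert_iff, Set.mem_ofPred_eq]
      grind
    rw [this, one_mul]

theorem fockSign_diff {S : Set ℤ} (h : IsFockF S) {i : ℤ} (hi : i ∈ S) (j : ℤ) :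
    fockSign (S \ {i}) j = (if j < i then -1 else 1) * fockSign S j := by
  have key := fockSign_insert (h.diff i) (i := i) (by simp) j
  rw [Set.insert_sdiff_singleton, Set.insert_eq_of_mem hi] at key
  rw [key]
  split_ifs <;> ring

theorem wedgeF_fockMonomial {S : Set ℤ} (hS : IsFockF S) (j : ℤ) :
    wedgeF j (fockMonomial hS) =
      if j ∈ S then 0 else fockSign S j • fockMonomial (hS.insert j) :=
  (Finsupp.linearCombination_single ..).trans (one_smul ..)

theorem contrF_fockMonomial {S : Set ℤ} (hS : IsFockF S) (j : ℤ) :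
    contrF j (fockMonomial hS) =
      if j ∈ S then fockSign S j • fockMonomial (hS.diff j) else 0 :=
  (Finsupp.linearCombination_single ..).trans (one_smul ..)

theorem wedgeF_of_mem {S : Set ℤ} {hS : IsFockF S} {j : ℤ} (h : j ∈ S) :
    wedgeF j (fockMonomial hS) = 0 :=
  (wedgeF_fockMonomial hS j).trans (if_pos h)

theorem wedgeF_of_notMem {S : Set ℤ} {hS : IsFockF S} {j : ℤ} (h : j ∉ S) :
    wedgeF j (fockMonomial hS) = fockSign S j • fockMonomial (hS.insert j) :=
  (wedgeF_fockMonomial hS j).trans (if_neg h)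

theorem contrF_of_mem {S : Set ℤ} {hS : IsFockF S} {j : ℤ} (h : j ∈ S) :
    contrF j (fockMonomial hS) = fockSign S j • fockMonomial (hS.diff j) :=
  (contrF_fockMonomial hS j).trans (if_pos h)

theorem contrF_of_notMem {S : Set ℤ} {hS : IsFockF S} {j : ℤ} (h : j ∉ S) :
    contrF j (fockMonomial hS) = 0 :=
  (contrF_fockMonomial hS j).trans (if_neg h)

theorem fockEnd_ext {f g : Module.End ℂ FSp}
    (h : ∀ (S : Set ℤ) (hS : IsFockF S), f (fockMonomial hS) = g (fockMonomial hS)) : f = g :=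
  Finsupp.lhom_ext' fun x => LinearMap.ext_ring (h x.1 x.2)

theorem wedgeF_contrF_anticomm_self (j : ℤ) :
    wedgeF j * contrF j + contrF j * wedgeF j = 1 := by
  refine fockEnd_ext fun S hS => ?_
  simp only [LinearMap.add_apply, Module.End.mul_apply, Module.End.one_apply]
  by_cases hj : j ∈ S
  · have hx := fockMonomial_congr ((hS.diff j).insert j) (T := S) (by simp [hj])
    rw [wedgeF_of_mem hj, contrF_of_mem hj, map_smul, map_zero, add_zero,
      wedgeF_of_notMem (by simp), smul_smul, fockSign_diff hS hj, hx]
    simp [fockSign_mul_self]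
  · have hx := fockMonomial_congr ((hS.insert j).diff j) (T := S) (by simp [hj])
    rw [contrF_of_notMem hj, wedgeF_of_notMem hj, map_smul, map_zero, zero_add,
      contrF_of_mem (by simp), smul_smul, fockSign_insert hS hj, hx]
    simp [fockSign_mul_self]

theorem wedgeF_contrF_anticomm_of_ne {i j : ℤ} (hij : i ≠ j) :
    wedgeF i * contrF j + contrF j * wedgeF i = 0 := by
  refine fockEnd_ext fun S hS => ?_
  simp only [LinearMap.add_apply, Module.End.mul_apply, LinearMap.zero_apply]
  by_cases hi : i ∈ S <;> by_cases hj : j ∈ S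
  · rw [wedgeF_of_mem hi, contrF_of_mem hj, map_smul, wedgeF_of_mem (by simp [hi, hij])]
    simp
  · rw [wedgeF_of_mem hi, contrF_of_notMem hj]
    simp
  · have hx := fockMonomial_congr ((hS.insert i).diff j)
      (Set.insert_sdiff_singleton_comm hij S).symm
    rw [contrF_of_mem hj, wedgeF_of_notMem hi, map_smul, map_smul,
      wedgeF_of_notMem (by simp [hi]), contrF_of_mem (by simp [hj]), hx, smul_smul, smul_smul,
      ← add_smul, fockSign_diff hS hj, fockSign_insert hS hi]
    rcases hij.lt_or_gt with h | h <;> simp [h, h.not_gt, mul_comm]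
  · rw [contrF_of_notMem hj, wedgeF_of_notMem hi, map_smul,
      contrF_of_notMem (by simp [hj, hij.symm])]
    simp

theorem wedgeF_mul_self (j : ℤ) : wedgeF j * wedgeF j = 0 := by
  refine fockEnd_ext fun S hS => ?_
  rw [Module.End.mul_apply, LinearMap.zero_apply]
  by_cases hj : j ∈ S
  · rw [wedgeF_of_mem hj, map_zero]
  · rw [wedgeF_of_notMem hj, map_smul, wedgeF_of_mem (by simp), smul_zero]

theorem contrF_mul_self (j : ℤ) : contrF j * contrF j = 0 := by
  refine fockEnd_ext fun S hS => ?_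
  rw [Module.End.mul_apply, LinearMap.zero_apply]
  by_cases hj : j ∈ S
  · rw [contrF_of_mem hj, map_smul, contrF_of_notMem (by simp), smul_zero]
  · rw [contrF_of_notMem hj, map_zero]

theorem wedgeF_anticomm (i j : ℤ) : wedgeF i * wedgeF j + wedgeF j * wedgeF i = 0 := by
  rcases eq_or_ne i j with rfl | hij
  · rw [wedgeF_mul_self, add_zero]
  refine fockEnd_ext fun S hS => ?_
  simp only [LinearMap.add_apply, Module.End.mul_apply, LinearMap.zero_apply]
  by_cases hi : i ∈ S <;> by_cases hj : j ∈ S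
  · rw [wedgeF_of_mem hi, wedgeF_of_mem hj]
    simp
  · rw [wedgeF_of_mem hi, wedgeF_of_notMem hj, map_smul, wedgeF_of_mem (by simp [hi])]
    simp
  · rw [wedgeF_of_mem hj, wedgeF_of_notMem hi, map_smul, wedgeF_of_mem (by simp [hj])]
    simp
  · have hx := fockMonomial_congr ((hS.insert j).insert i) (Set.insert_comm i j S)
    rw [wedgeF_of_notMem hj, wedgeF_of_notMem hi, map_smul, map_smul,
      wedgeF_of_notMem (by simp [hi, hij]), wedgeF_of_notMem (by simp [hj, hij.symm]), hx,
      smul_smul, smul_smul, ← add_smul, fockSign_insert hS hj, fockSign_insert hS hi]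
    rcases hij.lt_or_gt with h | h <;> simp [h, h.not_gt, mul_comm]

theorem contrF_anticomm (i j : ℤ) : contrF i * contrF j + contrF j * contrF i = 0 := by
  rcases eq_or_ne i j with rfl | hij
  · rw [contrF_mul_self, add_zero]
  refine fockEnd_ext fun S hS => ?_
  simp only [LinearMap.add_apply, Module.End.mul_apply, LinearMap.zero_apply]
  by_cases hi : i ∈ S <;> by_cases hj : j ∈ S
  · have hx := fockMonomial_congr ((hS.diff j).diff i) Set.sdiff_sdiff_comm
    rw [contrF_of_mem hj, contrF_of_mem hi, map_smul, map_smul,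
      contrF_of_mem (by simp [hi, hij]), contrF_of_mem (by simp [hj, hij.symm]), hx,
      smul_smul, smul_smul, ← add_smul, fockSign_diff hS hj, fockSign_diff hS hi]
    rcases hij.lt_or_gt with h | h <;> simp [h, h.not_gt, mul_comm]
  · rw [contrF_of_notMem hj, contrF_of_mem hi, map_smul, contrF_of_notMem (by simp [hj])]
    simp
  · rw [contrF_of_notMem hi, contrF_of_mem hj, map_smul, contrF_of_notMem (by simp [hi])]
    simp
  · rw [contrF_of_notMem hi, contrF_of_notMem hj]
    simp

theorem wedgeF_contrF_anticomm (i j : ℤ) :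
    wedgeF i * contrF j + contrF j * wedgeF i =
      if i = j then (1 : Module.End ℂ FSp) else 0 := by
  split_ifs with hij
  · exact hij ▸ wedgeF_contrF_anticomm_self i
  · exact wedgeF_contrF_anticomm_of_ne hij

/-- The Fock space representation of the Clifford algebra. -/
noncomputable def fockRep : ClC →ₐ[ℂ] Module.End ℂ FSp :=
  RingQuot.liftAlgHom ℂ ⟨FreeAlgebra.lift ℂ (Sum.elim wedgeF contrF), by
    rintro _ _ (⟨i, j⟩ | ⟨i, j⟩ | ⟨i, j⟩)
    · simp only [map_add, map_mul, FreeAlgebra.lift_ι_apply, Sum.elim_inl, Sum.elim_inr,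
        wedgeF_contrF_anticomm, apply_ite (FreeAlgebra.lift ℂ (Sum.elim wedgeF contrF)),
        map_one, map_zero]
    · simp [wedgeF_anticomm]
    · simp [contrF_anticomm]⟩

theorem fockRep_psi (j : ℤ) : fockRep (psi j) = wedgeF j := by
  simp [fockRep, psi]

theorem fockRep_psiStar (j : ℤ) : fockRep (psiStar j) = contrF j := by
  simp [fockRep, psiStar]

/-- there is a ℂ-algebra homomorphism `Cl → End_ℂ(F)` sending `ψ_j`
to the wedging operator and `ψ_j^*` to the contracting operator; equivalently,
these operators satisfy the canonical anticommutation relations. -/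
theorem fock_space_representation :
    (∃ G : ClC →ₐ[ℂ] Module.End ℂ FSp,
        (∀ j : ℤ, G (psi j) = wedgeF j) ∧ (∀ j : ℤ, G (psiStar j) = contrF j)) ∧
    (∀ i j : ℤ, wedgeF i * contrF j + contrF j * wedgeF i
        = if i = j then (1 : Module.End ℂ FSp) else 0) ∧
    (∀ i j : ℤ, wedgeF i * wedgeF j + wedgeF j * wedgeF i = 0) ∧
    (∀ i j : ℤ, contrF i * contrF j + contrF j * contrF i = 0) :=
  ⟨⟨fockRep, fockRep_psi, fockRep_psiStar⟩, wedgeF_contrF_anticomm, wedgeF_anticomm,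
    contrF_anticomm⟩
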